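/- arXiv:math/0109093 — 2 statements merged into one kernel-verified Lean document; each statement's English description precedes it below -/
import Mathlib

section
/- For every k ≥ 1, the Catalan number C_k = (1/(k+1))·binom(2k,k) equals the number of pairs (u,v) ∈ S_k × S_k such that uv is the k-cycle (1,2,…,k) and κ(u) + κ(v) = k + 1, where κ(w) denotes the number of cycles of the permutation w. -/
/-- The number of cycles `κ(w)` of a permutation (fixed points included). -/
def cyclesCount {k : ℕ} (w : Equiv.Perm (Fin k)) : ℕ := w.partition.parts.card

open Equiv Equiv.Perm

section
variable {α : Type*} [Fintype α] [DecidableEq α]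

/-- reflection length -/
def elen (w : Perm α) : ℕ := (w.cycleType.map (fun n => n - 1)).sum

lemma elen_one : elen (1 : Perm α) = 0 := by simp [elen]

lemma formPerm_split {α : Type*} [DecidableEq α] (a b : α) (l1 l2 : List α) (h : (a :: l1 ++ b :: l2).Nodup) :
    swap a b * (a :: l1 ++ b :: l2).formPerm = (a :: l1).formPerm * (b :: l2).formPerm := by
  induction l1 generalizing a with
  | nil => simp
  | cons x l1 ih =>
    have h' : (x :: l1 ++ b :: l2).Nodup := (List.nodup_cons.1 h).2
    have e := ih x h'
    have e2 : (x :: l1 ++ b :: l2).formPerm = swap x b * ((x :: l1).formPerm * (b :: l2).formPerm) := by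
      rw [← e]; simp
    have e3 : (a :: x :: l1 ++ b :: l2).formPerm = swap a x * (x :: l1 ++ b :: l2).formPerm := by
      simp
    rw [e3, e2, List.formPerm_cons_cons]
    have hab : a ≠ b := by rintro rfl; simp at h
    have hax : a ≠ x := by rintro rfl; simp at h
    have hxb : x ≠ b := by rintro rfl; simp at h
    have : swap a b * (swap a x * swap x b) = swap a x := by
      ext y
      simp only [Perm.mul_apply, swap_apply_def]
      split_ifs <;> simp_all
    simp only [← mul_assoc] at this ⊢
    rw [this]

lemma elen_formPerm_mul (a : α) (l : List α) (d : Perm α) (h : (a :: l).Nodup)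
    (hd : ∀ x ∈ a :: l, d x = x) : elen ((a :: l).formPerm * d) = l.length + elen d := by
  cases l with
  | nil => simp
  | cons b l =>
    have hdis : Perm.Disjoint (a :: b :: l).formPerm d := by
      intro x
      by_cases hx : x ∈ a :: b :: l
      · exact Or.inr (hd x hx)
      · exact Or.inl (List.formPerm_apply_of_notMem hx)
    have hs : (a :: b :: l).formPerm.support = (a :: b :: l).toFinset :=
      List.support_formPerm_of_nodup _ h (by simp)
    rw [elen, hdis.cycleType_mul, (List.isCycle_formPerm h (by simp)).cycleType, hs,
      List.toFinset_card_of_nodup h]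
    simp [elen]

lemma exists_cycle_decomp (w : Perm α) (a : α) : ∃ (l : List α) (d : Perm α),
    (a :: l).Nodup ∧ (∀ x ∈ a :: l, d x = x) ∧ w = (a :: l).formPerm * d := by
  by_cases ha : w a = a
  · exact ⟨[], w, by simp, by simpa using ha, by simp⟩
  · have h1 := Equiv.Perm.formPerm_toList w a
    have hn := Equiv.Perm.nodup_toList w a
    have hm : ∀ y, y ∈ toList w a ↔ SameCycle w a y ∧ a ∈ w.support := fun y => mem_toList_iff
    have h0 : toList w a ≠ [] := by
      intro h
      have := (hm a).2 ⟨SameCycle.refl _ _, mem_support.2 ha⟩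
      rw [h] at this; simp at this
    obtain ⟨c, l, hl⟩ := List.exists_cons_of_ne_nil h0
    have hc : c = a := by
      have : (toList w a)[0]? = some a := by
        rw [List.getElem?_eq_getElem (by rw [hl]; simp)]
        rw [Equiv.Perm.getElem_toList]; simp
      rw [hl] at this; simpa using this
    subst hc
    rw [hl] at h1 hn hm
    refine ⟨l, (cycleOf w c)⁻¹ * w, hn, ?_, by rw [h1]; group⟩
    intro x hx
    have := ((hm x).1 hx).1
    rw [Perm.mul_apply, Perm.inv_eq_iff_eq]
    exact (this.cycleOf_apply).symm

lemma elen_swap_notMem (a b : α) (l : List α) (d : Perm α) (h : (a :: l).Nodup)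
    (hd : ∀ x ∈ a :: l, d x = x) (hb : b ∉ a :: l) :
    elen (swap a b * ((a :: l).formPerm * d)) = elen ((a :: l).formPerm * d) + 1 := by
  obtain ⟨l2, d', hn, hd', rfl⟩ := exists_cycle_decomp d b
  have hx : ∀ x ∈ a :: l, x ∉ b :: l2 := by
    intro x hx hx2
    have h1 := hd x hx
    rw [Perm.mul_apply, hd' x hx2] at h1
    have hxb : x ≠ b := by rintro rfl; exact hb hx
    cases l2 with
    | nil => simp at hx2; exact hxb hx2
    | cons y l2 =>
      exact (List.formPerm_apply_mem_ne_self_iff _ hn x hx2).2 (by simp) h1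
  have hN : (a :: l ++ b :: l2).Nodup := by
    rw [List.nodup_append]
    refine ⟨h, hn, ?_⟩
    rintro x hx1 y hy rfl
    exact hx x hx1 hy
  have hfix : ∀ x ∈ a :: l ++ b :: l2, d' x = x := by
    intro x hxm
    rcases List.mem_append.1 hxm with h1 | h1
    · have h2 := hd x h1
      rw [Perm.mul_apply] at h2
      by_contra h3
      have h4 : d' x ∉ b :: l2 := by
        intro h5
        exact h3 (d'.injective (hd' _ h5))
      rw [List.formPerm_apply_of_notMem h4] at h2
      exact h3 h2
    · exact hd' x h1
  have e := formPerm_split a b l l2 hN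
  have e1 : swap a b * ((a :: l).formPerm * ((b :: l2).formPerm * d')) =
      (a :: (l ++ b :: l2)).formPerm * d' := by
    rw [← mul_assoc (a::l).formPerm, ← e]
    simp [← mul_assoc]
  rw [e1, elen_formPerm_mul a (l ++ b :: l2) d' hN hfix, elen_formPerm_mul a l _ h hd,
    elen_formPerm_mul b l2 d' hn hd']
  simp; omega

lemma elen_swap_fixed (a b : α) (w : Perm α) (ha : w a = a) (hb : b ≠ a) :
    elen (swap a b * w) = elen w + 1 := by
  simpa using elen_swap_notMem a b [] w (by simp) (by simpa using ha) (by simpa using hb)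

lemma elen_split (a b : α) (l1 l2 : List α) (d : Perm α) (h : (a :: l1 ++ b :: l2).Nodup)
    (hd : ∀ x ∈ a :: l1 ++ b :: l2, d x = x) :
    elen (swap a b * ((a :: l1 ++ b :: l2).formPerm * d)) + 1 =
      elen ((a :: l1 ++ b :: l2).formPerm * d) := by
  rw [← mul_assoc, formPerm_split _ _ _ _ h, mul_assoc]
  have hn := List.nodup_append.1 h
  rw [elen_formPerm_mul a l1 _ hn.1, elen_formPerm_mul b l2 _ hn.2.1,
    List.cons_append, elen_formPerm_mul a (l1 ++ b :: l2) d h hd]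
  · simp; omega
  · intro x hx; exact hd x (List.mem_append_right _ hx)
  · intro x hx
    rw [Perm.mul_apply, hd x (List.mem_append_left _ hx), List.formPerm_apply_of_notMem]
    intro hx2; exact hn.2.2 x hx x hx2 rfl

lemma elen_swap_le (a b : α) (w : Perm α) : elen (swap a b * w) ≤ elen w + 1 := by
  by_cases hab : b = a
  · subst hab; rw [swap_self, ← Perm.one_def, one_mul]; omega
  obtain ⟨l, d, hn, hd, rfl⟩ := exists_cycle_decomp w a
  by_cases hb : b ∈ l
  · obtain ⟨l1, l2, rfl⟩ := List.append_of_mem hb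
    have := elen_split a b l1 l2 d hn hd
    simp only [List.cons_append] at this
    omega
  · exact (elen_swap_notMem a b l d hn hd (by simp [hab, hb])).le

lemma exists_swap_of_apply_ne (u : Perm α) (a : α) (h : u a ≠ a) :
    (swap a (u a) * u) a = a ∧ elen u = elen (swap a (u a) * u) + 1 := by
  have h1 : (swap a (u a) * u) a = a := by simp
  refine ⟨h1, ?_⟩
  rw [← elen_swap_fixed a (u a) _ h1 h]
  simp

lemma elen_mul_le (u v : Perm α) : elen (u * v) ≤ elen u + elen v := by
  induction hn : elen u generalizing u with
  | zero =>
    have : u = 1 := by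
      ext a
      by_contra h
      have := (exists_swap_of_apply_ne u a h).2
      omega
    simp [this]
  | succ n ih =>
    have : u ≠ 1 := by rintro rfl; simp [elen_one] at hn
    obtain ⟨a, ha⟩ : ∃ a, u a ≠ a := by
      by_contra! h; exact this (Equiv.ext h)
    have h1 := (exists_swap_of_apply_ne u a ha).2
    have h2 := ih (swap a (u a) * u) (by omega)
    have h3 := elen_swap_le a (u a) (swap a (u a) * u * v)
    rw [← mul_assoc, ← mul_assoc, swap_mul_self, one_mul] at h3
    omega

/-- product of the cycles given by a list of lists -/
def cycProd (L : List (List α)) : Perm α := (L.map List.formPerm).prod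

/-- permutations below `cycProd L` supported on `L.flatten` -/
def below (L : List (List α)) : Finset (Perm α) :=
  Finset.univ.filter fun u => (∀ x, x ∉ L.flatten → u x = x) ∧
    elen u + elen (u⁻¹ * cycProd L) = elen (cycProd L)

lemma mem_below (L : List (List α)) (u : Perm α) : u ∈ below L ↔
    (∀ x, x ∉ L.flatten → u x = x) ∧
    elen u + elen (u⁻¹ * cycProd L) = elen (cycProd L) := by simp [below]

lemma cycProd_cons (l : List α) (L : List (List α)) :
    cycProd (l :: L) = l.formPerm * cycProd L := by simp [cycProd]

lemma cycProd_fix (L : List (List α)) (x : α) (hx : x ∉ L.flatten) : cycProd L x = x := by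
  induction L with
  | nil => simp [cycProd]
  | cons l L ih =>
    rw [List.flatten_cons, List.mem_append, not_or] at hx
    rw [cycProd_cons, Perm.mul_apply, ih hx.2, List.formPerm_apply_of_notMem hx.1]

lemma below_fixed (a : α) (t : List α) (L : List (List α)) (h : ((a :: t) :: L).flatten.Nodup) :
    (below ((a :: t) :: L)).filter (fun u => u a = a) = below (t :: L) := by
  have h' : (a :: (t :: L).flatten).Nodup := by simpa using h
  have hat : a ∉ (t :: L).flatten := (List.nodup_cons.1 h').1
  ext u
  rw [Finset.mem_filter, mem_below, mem_below]
  have key : u a = a → (elen u + elen (u⁻¹ * cycProd ((a :: t) :: L)) = elen (cycProd ((a :: t) :: L))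
      ↔ elen u + elen (u⁻¹ * cycProd (t :: L)) = elen (cycProd (t :: L))) := by
    intro hu
    cases t with
    | nil => simp [cycProd_cons]
    | cons x t =>
      have hxa : x ≠ a := by rintro rfl; simp at hat
      have e : cycProd ((a :: x :: t) :: L) = swap a x * cycProd ((x :: t) :: L) := by
        rw [cycProd_cons, cycProd_cons, List.formPerm_cons_cons, mul_assoc]
      have hui : u⁻¹ a = a := by rw [Perm.inv_eq_iff_eq]; exact hu.symm
      have e2 : u⁻¹ * cycProd ((a :: x :: t) :: L) =
          swap a (u⁻¹ x) * (u⁻¹ * cycProd ((x :: t) :: L)) := by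
        rw [e, ← mul_assoc, ← mul_assoc, Equiv.mul_swap_eq_swap_mul, hui]
      have hfix := cycProd_fix _ a hat
      rw [e2, e, elen_swap_fixed _ _ _ hfix hxa, elen_swap_fixed]
      · omega
      · rw [Perm.mul_apply, hfix, hui]
      · rw [ne_eq, Perm.inv_eq_iff_eq, hu]; exact hxa
  constructor
  · rintro ⟨⟨h1, h2⟩, h3⟩
    refine ⟨fun x hx => ?_, (key h3).1 h2⟩
    by_cases hxa : x = a
    · rw [hxa, h3]
    · exact h1 x (by simpa [hxa] using hx)
  · rintro ⟨h1, h2⟩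
    have h3 := h1 a hat
    refine ⟨⟨fun x hx => h1 x ?_, (key h3).2 h2⟩, h3⟩
    intro hx2; apply hx
    simp at hx2 ⊢; tauto

lemma below_apply_mem (a : α) (t : List α) (L : List (List α))
    (h : ((a :: t) :: L).flatten.Nodup) (u : Perm α) (hu : u ∈ below ((a :: t) :: L)) :
    u a ∈ a :: t := by
  by_contra hj
  rw [mem_below] at hu
  have hn : (a :: t ++ L.flatten).Nodup := h
  rw [List.nodup_append] at hn
  have h1 := elen_swap_notMem a (u a) t (cycProd L) hn.1
    (fun x hx => cycProd_fix L x (fun hx2 => hn.2.2 x hx x hx2 rfl)) hj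
  rw [← cycProd_cons] at h1
  have hne : u a ≠ a := by intro h0; rw [h0] at hj; simp at hj
  have h2 := (exists_swap_of_apply_ne u a hne).2
  have h3 := elen_mul_le (swap a (u a) * u) (u⁻¹ * cycProd ((a :: t) :: L))
  have e : swap a (u a) * u * (u⁻¹ * cycProd ((a :: t) :: L)) =
    swap a (u a) * cycProd ((a :: t) :: L) := by group
  rw [e] at h3
  omega

lemma below_split (a b : α) (t1 t2 : List α) (L : List (List α))
    (h : ((a :: t1 ++ b :: t2) :: L).flatten.Nodup) :
    ((below ((a :: t1 ++ b :: t2) :: L)).filter (fun u => u a = b)).card =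
    ((below ((a :: t1) :: (b :: t2) :: L)).filter (fun u => u a = a)).card := by
  have hn : ((a :: t1 ++ b :: t2) ++ L.flatten).Nodup := h
  rw [List.nodup_append] at hn
  have hfix : ∀ x ∈ a :: t1 ++ b :: t2, cycProd L x = x :=
    (fun x hx => cycProd_fix L x (fun hx2 => hn.2.2 x hx x hx2 rfl))
  have hba : b ≠ a := by rintro rfl; simp at hn
  have hE := elen_split a b t1 t2 (cycProd L) hn.1 hfix
  rw [← cycProd_cons] at hE
  have hP : cycProd ((a :: t1) :: (b :: t2) :: L) =
      swap a b * cycProd ((a :: t1 ++ b :: t2) :: L) := by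
    rw [cycProd_cons, cycProd_cons, cycProd_cons, ← mul_assoc, ← mul_assoc,
      formPerm_split _ _ _ _ hn.1]
  rw [← hP] at hE
  have hF : ((a :: t1) :: (b :: t2) :: L).flatten = ((a :: t1 ++ b :: t2) :: L).flatten := by simp
  have hma : a ∈ ((a :: t1 ++ b :: t2) :: L).flatten := by simp
  have hmb : b ∈ ((a :: t1 ++ b :: t2) :: L).flatten := by simp
  have hsw : ∀ x, x ∉ ((a :: t1 ++ b :: t2) :: L).flatten → swap a b x = x := fun x hx =>
    swap_apply_of_ne_of_ne (by rintro rfl; exact hx hma) (by rintro rfl; exact hx hmb)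
  have hl : ∀ u : Perm α, u a = b → elen u = elen (swap a b * u) + 1 := by
    intro u hu
    have := (exists_swap_of_apply_ne u a (by rw [hu]; exact hba)).2
    rwa [hu] at this
  have hinv : ∀ u : Perm α, (swap a b * u)⁻¹ * cycProd ((a :: t1) :: (b :: t2) :: L)
      = u⁻¹ * cycProd ((a :: t1 ++ b :: t2) :: L) := by
    intro u
    rw [hP, mul_inv_rev, swap_inv, mul_assoc, ← mul_assoc (swap a b), swap_mul_self, one_mul]
  refine Finset.card_bij' (fun u _ => swap a b * u) (fun u _ => swap a b * u) ?_ ?_ ?_ ?_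
  · intro u hu
    rw [Finset.mem_filter, mem_below] at hu ⊢
    obtain ⟨⟨h1, h2⟩, h3⟩ := hu
    refine ⟨⟨fun x hx => ?_, ?_⟩, by simp [h3]⟩
    · rw [hF] at hx
      rw [Perm.mul_apply, h1 x hx, hsw x hx]
    · have := hl u h3
      rw [hinv]; omega
  · intro u hu
    rw [Finset.mem_filter, mem_below] at hu ⊢
    obtain ⟨⟨h1, h2⟩, h3⟩ := hu
    have h4 : (swap a b * u) a = b := by simp [h3]
    refine ⟨⟨fun x hx => ?_, ?_⟩, h4⟩
    · rw [Perm.mul_apply, h1 x (by rwa [hF]), hsw x hx]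
    · have h5 := hl _ h4
      have h6 := hinv (swap a b * u)
      rw [← mul_assoc (swap a b), swap_mul_self, one_mul] at h5 h6
      rw [← h6]; omega
  · intro u _; simp [← mul_assoc]
  · intro u _; simp [← mul_assoc]

lemma card_below_cons (a : α) (t : List α) (L : List (List α))
    (h : ((a :: t) :: L).flatten.Nodup) :
    (below ((a :: t) :: L)).card = (below (t :: L)).card +
      ∑ i : Fin t.length, (below (t.take i :: t.drop i :: L)).card := by
  have hn : (a :: t ++ L.flatten).Nodup := h
  have hnt : (a :: t).Nodup := (List.nodup_append.1 hn).1
  have h1 : (below ((a :: t) :: L)).card = ∑ j ∈ (a :: t).toFinset,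
      ((below ((a :: t) :: L)).filter (fun u => u a = j)).card :=
    Finset.card_eq_sum_card_fiberwise (f := fun u : Perm α => u a) (fun u hu => by
      have := below_apply_mem a t L h u hu
      simpa using this)
  rw [h1, List.sum_toFinset _ hnt, List.map_cons, List.sum_cons, below_fixed a t L h]
  congr 1
  rw [← List.sum_ofFn, ← List.ofFn_getElem_eq_map]
  congr 2
  funext i
  have e : t = t.take i ++ t[i] :: t.drop (i + 1) := by simp
  have e' : t.drop i = t[i] :: t.drop (i + 1) := by simp
  have h2 := below_split a t[i] (t.take i) (t.drop (i + 1)) L (by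
    rw [List.cons_append, ← e]; exact h)
  rw [List.cons_append, ← e] at h2
  refine h2.trans ?_
  rw [below_fixed, ← e']
  rw [← e']
  simpa [← List.append_assoc] using h

lemma card_below (n : ℕ) : ∀ (L : List (List α)), L.flatten.length + L.length ≤ n + L.length →
    L.flatten.Nodup → (below L).card = (L.map (fun l => catalan l.length)).prod := by
  induction n using Nat.strong_induction_on with
  | _ n IH =>
  intro L
  induction L with
  | nil =>
    intro _ _
    have : below ([] : List (List α)) = {1} := by
      ext u
      rw [mem_below, Finset.mem_singleton]
      constructor
      · rintro ⟨h1, -⟩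
        exact Equiv.ext fun x => h1 x (by simp)
      · rintro rfl
        simp [cycProd, elen_one]
    simp [this]
  | cons l L ihL =>
    intro hlen hnd
    cases l with
    | nil =>
      have : below ([] :: L) = below L := by
        ext u; simp [mem_below, cycProd_cons]
      rw [this, ihL (by simp at hlen ⊢; omega) (by simpa using hnd)]
      simp
    | cons a t =>
      have hn' : (t ++ L.flatten).Nodup := (List.nodup_cons.1 (by simpa using hnd)).2
      have hl' : t.length + L.flatten.length < n := by
        simp at hlen ⊢; omega
      rw [card_below_cons a t L hnd,
        IH (t.length + L.flatten.length) hl' (t :: L) (by simp) (by simpa using hn')]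
      have : ∀ i : Fin t.length, (below (t.take i :: t.drop i :: L)).card =
          catalan i * catalan (t.length - i) * (L.map (fun l => catalan l.length)).prod := by
        intro i
        rw [IH (t.length + L.flatten.length) hl' _ _ _]
        · have : min (i : ℕ) t.length = i := by omega
          simp [mul_assoc, this]
        · simp; omega
        · simpa [← List.append_assoc] using hn'
      rw [Finset.sum_congr rfl (fun i _ => this i), ← Finset.sum_mul]
      simp only [List.map_cons, List.prod_cons, List.length_cons, catalan_succ]
      rw [Fin.sum_univ_castSucc]
      simp
      ring

end

lemma cyclesCount_add_elen {k : ℕ} (w : Perm (Fin k)) : cyclesCount w + elen w = k := by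
  have h1 : ∀ s : Multiset ℕ, (∀ n ∈ s, 2 ≤ n) →
      (s.map (fun n => n - 1)).sum + Multiset.card s = s.sum := by
    intro s
    induction s using Multiset.induction_on with
    | empty => simp
    | cons a s ih =>
      intro h
      have h2 := ih (fun n hn => h n (Multiset.mem_cons_of_mem hn))
      have h3 := h a (Multiset.mem_cons_self a s)
      simp only [Multiset.map_cons, Multiset.sum_cons, Multiset.card_cons]
      omega
  have h2 := h1 w.cycleType (fun n hn => two_le_of_mem_cycleType hn)
  have h3 := w.sum_cycleType_le
  have h4 := w.sum_cycleType
  rw [cyclesCount, parts_partition, Multiset.card_add, Multiset.card_replicate, elen]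
  simp only [Fintype.card_fin] at *
  omega

lemma finRotate_eq_formPerm (k : ℕ) : finRotate k = (List.finRange k).formPerm := by
  ext i
  have h := List.formPerm_apply_getElem (List.finRange k) (List.nodup_finRange k) i (by simp)
  cases k with
  | zero => exact i.elim0
  | succ n =>
    simp at h
    rw [h, finRotate_succ_apply, Fin.val_add]
    simp

/-- For `k ≥ 1`, the Catalan number `C_k = (1/(k+1)) binom(2k,k)` counts the pairs
`(u,v)` of permutations of `{1,…,k}` with `uv = (1,2,…,k)` and `κ(u) + κ(v) = k + 1`. -/
theorem catalan_counts_cycle_factorizations (k : ℕ) (hk : 1 ≤ k) :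
    ((Finset.univ.filter fun uv : Equiv.Perm (Fin k) × Equiv.Perm (Fin k) =>
        uv.1 * uv.2 = finRotate k ∧ cyclesCount uv.1 + cyclesCount uv.2 = k + 1).card : ℚ)
      = ((2 * k).choose k : ℚ) / ((k : ℚ) + 1) := by
  have hP : cycProd [List.finRange k] = finRotate k := by
    simp [cycProd, finRotate_eq_formPerm]
  have hlen : elen (finRotate k) + 1 = k := by
    obtain ⟨n, rfl⟩ : ∃ n, k = n + 1 := ⟨k - 1, by omega⟩
    rw [finRotate_eq_formPerm]
    have h := List.nodup_finRange (n + 1)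
    have hl := List.length_finRange (n := n + 1)
    generalize List.finRange (n + 1) = l at h hl
    cases l with
    | nil => simp at hl
    | cons a l =>
      have := elen_formPerm_mul a l 1 h (by simp)
      rw [mul_one, elen_one] at this
      simp at hl
      omega
  have hcard : (Finset.univ.filter fun uv : Equiv.Perm (Fin k) × Equiv.Perm (Fin k) =>
        uv.1 * uv.2 = finRotate k ∧ cyclesCount uv.1 + cyclesCount uv.2 = k + 1).card
      = (below [List.finRange k]).card := by
    refine Finset.card_bij' (fun uv _ => uv.1) (fun u _ => (u, u⁻¹ * finRotate k)) ?_ ?_ ?_ ?_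
    · rintro ⟨u, v⟩ huv
      simp only [Finset.mem_filter, Finset.mem_univ, true_and] at huv
      rw [mem_below, hP]
      have e : u⁻¹ * finRotate k = v := by rw [← huv.1]; group
      refine ⟨by simp, ?_⟩
      have h1 := cyclesCount_add_elen u
      have h2 := cyclesCount_add_elen v
      dsimp only
      rw [e]; omega
    · intro u hu
      rw [mem_below, hP] at hu
      simp only [Finset.mem_filter, Finset.mem_univ, true_and]
      refine ⟨by group, ?_⟩
      have h1 := cyclesCount_add_elen u
      have h2 := cyclesCount_add_elen (u⁻¹ * finRotate k)
      omega
    · rintro ⟨u, v⟩ huv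
      simp only [Finset.mem_filter, Finset.mem_univ, true_and] at huv
      ext1
      · rfl
      · change u⁻¹ * finRotate k = v
        rw [← huv.1]; group
    · intro u _; rfl
  rw [hcard, card_below k _ (by simp) (by simpa using List.nodup_finRange k)]
  have h := succ_mul_catalan_eq_centralBinom k
  rw [Nat.centralBinom] at h
  rw [eq_div_iff (by positivity), ← h]
  simp [mul_comm]
end

section
/- For every k ≥ 1 and 1 ≤ i ≤ k, the Narayana number N(k,i) = (1/k)·binom(k,i)·binom(k,i−1) equals the number of pairs (u,v) ∈ S_k × S_k such that uv is the k-cycle (1,2,…,k), κ(u) = i, and κ(v) = k + 1 − i, where κ(w) denotes the number of cycles of the permutation w. -/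
namespace Nara

open Equiv Equiv.Perm Finset

/-! ### Number of cycles as number of orbits -/

open Classical in
theorem cyclesCount_eq_card {k : ℕ} (σ : Perm (Fin k)) :
    cyclesCount σ = Nat.card (Quotient (SameCycle.setoid σ)) := by
  let F : Fin k → Perm (Fin k) ⊕ Fin k := fun x =>
    if σ x = x then Sum.inr x else Sum.inl (cycleOf σ x)
  have hker : SameCycle.setoid σ = Setoid.ker F := by
    ext x y
    rw [Setoid.ker_def]
    change SameCycle σ x y ↔ _
    by_cases hx : σ x = x
    · by_cases hy : σ y = y
      · simp only [F, hx, hy, if_true, Sum.inr.injEq]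
        constructor
        · rintro ⟨m, hm⟩
          rwa [zpow_apply_eq_self_of_apply_eq_self hx] at hm
        · rintro rfl; exact SameCycle.refl _ _
      · simp only [F, hx, hy, if_true, if_false, reduceCtorEq, iff_false]
        intro h
        exact hy (h.apply_eq_self_iff.1 hx)
    · by_cases hy : σ y = y
      · simp only [F, hx, hy, if_true, if_false, reduceCtorEq, iff_false]
        intro h
        exact hx (h.apply_eq_self_iff.2 hy)
      · simp only [F, hx, hy, if_false, Sum.inl.injEq]
        exact sameCycle_iff_cycleOf_eq_of_mem_support (mem_support.2 hx) (mem_support.2 hy)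
  have himg : Set.range F = ↑(σ.cycleFactorsFinset.disjSum (σ.supportᶜ)) := by
    ext z
    simp only [Set.mem_range, SetLike.mem_coe, Finset.mem_disjSum]
    constructor
    · rintro ⟨x, rfl⟩
      by_cases hx : σ x = x
      · right; exact ⟨x, by simp [hx], by simp [F, hx]⟩
      · left
        exact ⟨cycleOf σ x, cycleOf_mem_cycleFactorsFinset_iff.2 (mem_support.2 hx), by simp [F, hx]⟩
    · rintro (⟨c, hc, rfl⟩ | ⟨x, hx, rfl⟩)
      · obtain ⟨x, hx⟩ := (mem_cycleFactorsFinset_iff.1 hc).1.nonempty_support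
        have hc' := cycle_is_cycleOf hx hc
        have : σ x ≠ x := mem_support.1 (mem_cycleFactorsFinset_support_le hc hx)
        exact ⟨x, by simp [F, this, hc']⟩
      · have : σ x = x := by simpa using hx
        exact ⟨x, by simp [F, this]⟩
  rw [hker, Nat.card_congr (Setoid.quotientKerEquivRange F), himg]
  simp only [SetLike.coe_sort_coe, Nat.card_eq_fintype_card, Fintype.card_coe]
  rw [card_disjSum, card_compl]
  unfold cyclesCount
  rw [parts_partition, Multiset.card_add, Multiset.card_replicate]
  congr 1
  simp [cycleType_def]

theorem cyclesCount_inv {k : ℕ} (σ : Perm (Fin k)) : cyclesCount σ⁻¹ = cyclesCount σ := by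
  unfold cyclesCount
  rw [parts_partition, parts_partition, cycleType_inv, support_inv]

theorem cyclesCount_le {k : ℕ} (σ : Perm (Fin k)) : cyclesCount σ ≤ k := by
  rw [cyclesCount_eq_card]
  calc _ ≤ Nat.card (Fin k) := Nat.card_le_card_of_surjective _ Quotient.mk_surjective
    _ = k := by simp

theorem cyclesCount_pos {k : ℕ} (σ : Perm (Fin (k+1))) : 0 < cyclesCount σ := by
  rw [cyclesCount_eq_card]
  have : Nonempty (Quotient (SameCycle.setoid σ)) := ⟨Quotient.mk _ 0⟩
  exact Nat.card_pos

/-! ### minimal period -/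

theorem per_eq {α : Type*} {f : α → α} {x : α} {m : ℕ} (hm : 0 < m) (h1 : f^[m] x = x)
    (h2 : ∀ n, 0 < n → n < m → f^[n] x ≠ x) : Function.minimalPeriod f x = m := by
  have hp : Function.IsPeriodicPt f m x := h1
  refine le_antisymm (hp.minimalPeriod_le hm) ?_
  by_contra h
  exact h2 _ (hp.minimalPeriod_pos hm) (not_le.1 h) (Function.iterate_minimalPeriod)

theorem per_ne {α : Type*} {f : α → α} {x : α} {n : ℕ} (hn : 0 < n)
    (h : n < Function.minimalPeriod f x) : f^[n] x ≠ x := fun h1 =>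
  Function.not_isPeriodicPt_of_pos_of_lt_minimalPeriod hn.ne' h h1

theorem per_pos {k : ℕ} (σ : Perm (Fin k)) (x : Fin k) : 0 < Function.minimalPeriod σ x := by
  apply Function.minimalPeriod_pos_of_mem_periodicPts
  exact σ.injective.mem_periodicPts x

theorem per_le {k : ℕ} (σ : Perm (Fin k)) (x : Fin k) : Function.minimalPeriod σ x ≤ k := by
  have h : Set.InjOn (fun n => σ^[n] x) ↑(range (Function.minimalPeriod σ x)) := by
    intro a ha b hb hab
    simp only [coe_range, Set.mem_Iio] at ha hb
    exact (Function.iterate_eq_iterate_iff_of_lt_minimalPeriod ha hb).1 hab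
  have := Finset.card_le_card_of_injOn (s := range (Function.minimalPeriod σ x)) (t := univ)
    (fun n => σ^[n] x) (by simp) h
  simpa using this

theorem sameCycle_iff {k : ℕ} (σ : Perm (Fin k)) (x y : Fin k) :
    SameCycle σ x y ↔ ∃ m < Function.minimalPeriod σ x, σ^[m] x = y := by
  constructor
  · intro h
    obtain ⟨i, -, hi⟩ := h.exists_pow_eq'
    refine ⟨i % Function.minimalPeriod σ x, Nat.mod_lt _ (per_pos σ x), ?_⟩
    rw [Function.iterate_mod_minimalPeriod_eq, ← hi, iterate_eq_pow]
  · rintro ⟨m, -, rfl⟩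
    exact ⟨m, by simp [iterate_eq_pow]⟩

theorem iter_swap {k : ℕ} (τ : Perm (Fin k)) (a b : Fin k) (N : ℕ)
    (h : ∀ n, 0 < n → n < N → τ^[n] a ≠ a ∧ τ^[n] a ≠ b) :
    ∀ n < N, (swap a b * τ : Perm (Fin k))^[n] a = τ^[n] a := by
  intro n
  induction n with
  | zero => simp
  | succ n ih =>
    intro hn
    rw [Function.iterate_succ_apply', ih (by omega), Perm.mul_apply,
      ← Function.iterate_succ_apply' τ]
    exact swap_apply_of_ne_of_ne (h _ (by omega) hn).1 (h _ (by omega) hn).2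

theorem per_swap {k : ℕ} (τ : Perm (Fin k)) (a : Fin k) (m : ℕ) (hm : 0 < m)
    (hm' : m < Function.minimalPeriod τ a) :
    Function.minimalPeriod (swap a (τ^[m] a) * τ : Perm (Fin k)) a = m := by
  have key := iter_swap τ a (τ^[m] a) m (by
    intro n h0 hn
    refine ⟨per_ne h0 (by omega), fun h => ?_⟩
    have := (Function.iterate_eq_iterate_iff_of_lt_minimalPeriod (by omega) hm').1 h
    omega)
  apply per_eq hm
  · obtain ⟨m, rfl⟩ : ∃ q, m = q + 1 := ⟨m - 1, by omega⟩
    rw [Function.iterate_succ_apply', key m (by omega), Perm.mul_apply,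
      ← Function.iterate_succ_apply' τ, swap_apply_right]
  · intro n h0 hn
    rw [key n hn]
    exact per_ne h0 (by omega)

/-! ### effect of transposition on number of cycles -/

theorem sameCycle_swap {k : ℕ} (τ : Perm (Fin k)) (a b : Fin k) (h : ¬ SameCycle τ a b) :
    SameCycle (swap a b * τ) a b := by
  have hp := per_pos τ a
  have key := iter_swap τ a b (Function.minimalPeriod τ a) (by
    intro n h0 hn
    refine ⟨per_ne h0 hn, fun h' => h ((sameCycle_iff _ _ _).2 ⟨n, hn, h'⟩)⟩)
  refine ⟨(Function.minimalPeriod τ a : ℕ), ?_⟩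
  rw [zpow_natCast, ← iterate_eq_pow]
  obtain ⟨m, hm⟩ : ∃ q, Function.minimalPeriod τ a = q + 1 := ⟨_, (Nat.succ_pred_eq_of_pos hp).symm⟩
  have h2 : τ^[m+1] a = a := by rw [← hm]; exact Function.iterate_minimalPeriod
  rw [hm, Function.iterate_succ_apply', key m (by omega), Perm.mul_apply,
      ← Function.iterate_succ_apply' τ, h2, swap_apply_left]

theorem rel_of_step {α : Type*} (σ : Perm α) (R : Setoid α) (h : ∀ x, R x (σ x)) (x y : α)
    (hxy : SameCycle σ x y) : R x y := by
  have hn : ∀ (n : ℕ) x, R x ((σ ^ n) x) := by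
    intro n
    induction n with
    | zero => intro x; exact R.refl _
    | succ n ih =>
      intro x
      rw [pow_succ', Perm.mul_apply]
      exact R.trans (ih x) (h _)
  obtain ⟨m, rfl⟩ := hxy
  obtain ⟨n, rfl | rfl⟩ := m.eq_nat_or_neg
  · simpa using hn n x
  · have := hn n ((σ ^ (-(n:ℤ))) x)
    rw [zpow_neg, zpow_natCast, ← Perm.mul_apply, mul_inv_cancel, Perm.one_apply] at this
    rw [zpow_neg, zpow_natCast]
    exact R.symm this

theorem sameCycle_swap_of {k : ℕ} (τ : Perm (Fin k)) (a b : Fin k) (h : ¬ SameCycle τ a b)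
    (x y : Fin k) (hxy : SameCycle τ x y) : SameCycle (swap a b * τ) x y := by
  have hab := sameCycle_swap τ a b h
  refine rel_of_step τ (SameCycle.setoid (swap a b * τ)) ?_ x y hxy
  intro x
  change SameCycle _ _ _
  have h1 : SameCycle (swap a b * τ) x ((swap a b * τ) x) := sameCycle_apply_right.2 (SameCycle.refl _ _)
  rw [Perm.mul_apply] at h1
  by_cases ha : τ x = a
  · rw [ha, swap_apply_left] at h1
    rw [ha]; exact h1.trans hab.symm
  · by_cases hb : τ x = b
    · rw [hb, swap_apply_right] at h1
      rw [hb]; exact h1.trans hab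
    · rwa [swap_apply_of_ne_of_ne ha hb] at h1

theorem sameCycle_of_swap {k : ℕ} (τ : Perm (Fin k)) (a b : Fin k)
    (x y : Fin k) (hxy : SameCycle (swap a b * τ) x y) :
    SameCycle τ x y ∨ ((SameCycle τ x a ∨ SameCycle τ x b) ∧ (SameCycle τ y a ∨ SameCycle τ y b)) := by
  let R : Setoid (Fin k) :=
    { r := fun x y => SameCycle τ x y ∨
        ((SameCycle τ x a ∨ SameCycle τ x b) ∧ (SameCycle τ y a ∨ SameCycle τ y b))
      iseqv := by
        refine ⟨fun x => Or.inl (SameCycle.refl _ _), ?_, ?_⟩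
        · rintro x y (h | ⟨h1, h2⟩)
          · exact Or.inl h.symm
          · exact Or.inr ⟨h2, h1⟩
        · rintro x y z (h | ⟨h1, h2⟩) (h' | ⟨h1', h2'⟩)
          · exact Or.inl (h.trans h')
          · exact Or.inr ⟨h1'.imp h.trans h.trans, h2'⟩
          · exact Or.inr ⟨h1, h2.imp h'.symm.trans h'.symm.trans⟩
          · exact Or.inr ⟨h1, h2'⟩ }
  refine rel_of_step (swap a b * τ) R ?_ x y hxy
  intro x
  change SameCycle τ x _ ∨ _
  have h1 : SameCycle τ x (τ x) := sameCycle_apply_right.2 (SameCycle.refl _ _)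
  rw [Perm.mul_apply]
  by_cases ha : τ x = a
  · rw [ha] at h1 ⊢
    rw [swap_apply_left]
    exact Or.inr ⟨Or.inl h1, Or.inr (SameCycle.refl _ _)⟩
  · by_cases hb : τ x = b
    · rw [hb] at h1 ⊢
      rw [swap_apply_right]
      exact Or.inr ⟨Or.inr h1, Or.inl (SameCycle.refl _ _)⟩
    · rw [swap_apply_of_ne_of_ne ha hb]; exact Or.inl h1

open Classical in
/-- Merging two different cycles. -/
theorem cyclesCount_merge {k : ℕ} (τ : Perm (Fin k)) (a b : Fin k) (h : ¬ SameCycle τ a b) :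
    cyclesCount (swap a b * τ) + 1 = cyclesCount τ := by
  rw [cyclesCount_eq_card, cyclesCount_eq_card]
  let f : {q : Quotient (SameCycle.setoid τ) // q ≠ Quotient.mk _ b} →
      Quotient (SameCycle.setoid (swap a b * τ)) := fun q =>
    Quotient.map' (s₁ := SameCycle.setoid τ) (s₂ := SameCycle.setoid (swap a b * τ)) id
      (fun x y hxy => sameCycle_swap_of τ a b h x y hxy) q.1
  have hf : Function.Bijective f := by
    constructor
    · rintro ⟨p, hp⟩ ⟨q, hq⟩ hpq
      induction p using Quotient.inductionOn with | _ p
      induction q using Quotient.inductionOn with | _ q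
      have hp' : ¬ SameCycle τ p b := fun h' => hp (Quotient.sound h')
      have hq' : ¬ SameCycle τ q b := fun h' => hq (Quotient.sound h')
      have hpq' : SameCycle (swap a b * τ) p q := Quotient.exact hpq
      apply Subtype.ext
      apply Quotient.sound
      change SameCycle τ p q
      rcases sameCycle_of_swap τ a b p q hpq' with h1 | ⟨h1 | h1, h2 | h2⟩
      · exact h1
      · exact h1.trans h2.symm
      · exact absurd h2 hq'
      · exact absurd h1 hp'
      · exact absurd h1 hp'
    · intro q
      induction q using Quotient.inductionOn with | _ q
      by_cases hq : SameCycle τ q b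
      · refine ⟨⟨Quotient.mk _ a, fun h' => h (Quotient.exact h')⟩, Quotient.sound ?_⟩
        change SameCycle (swap a b * τ) a q
        exact (sameCycle_swap τ a b h).trans (sameCycle_swap_of τ a b h _ _ hq.symm)
      · exact ⟨⟨Quotient.mk _ q, fun h' => hq (Quotient.exact h')⟩, rfl⟩
  rw [← Nat.card_congr (Equiv.ofBijective f hf)]
  rw [Nat.card_eq_fintype_card, Nat.card_eq_fintype_card, Fintype.card_subtype_compl,
    Fintype.card_subtype_eq]
  have : 0 < Fintype.card (Quotient (SameCycle.setoid τ)) := Fintype.card_pos_iff.2 ⟨Quotient.mk _ b⟩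
  omega

theorem not_sameCycle_split {k : ℕ} (τ : Perm (Fin k)) (a b : Fin k) (hab : a ≠ b)
    (h : SameCycle τ a b) : ¬ SameCycle (swap a b * τ) a b := by
  obtain ⟨m, hm, rfl⟩ := (sameCycle_iff _ _ _).1 h
  have hm0 : 0 < m := by
    rcases Nat.eq_zero_or_pos m with rfl | h
    · simp at hab
    · exact h
  intro hs
  obtain ⟨n, hn, hn'⟩ := (sameCycle_iff _ _ _).1 hs
  rw [per_swap τ a m hm0 hm] at hn
  have key := iter_swap τ a (τ^[m] a) m (by
    intro n h0 hn
    refine ⟨per_ne h0 (by omega), fun h => ?_⟩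
    have := (Function.iterate_eq_iterate_iff_of_lt_minimalPeriod (by omega) hm).1 h
    omega)
  rw [key n hn] at hn'
  have := (Function.iterate_eq_iterate_iff_of_lt_minimalPeriod (by omega) hm).1 hn'
  omega

theorem cyclesCount_split {k : ℕ} (τ : Perm (Fin k)) (a b : Fin k) (hab : a ≠ b)
    (h : SameCycle τ a b) : cyclesCount (swap a b * τ) = cyclesCount τ + 1 := by
  have := cyclesCount_merge (swap a b * τ) a b (not_sameCycle_split τ a b hab h)
  rw [← mul_assoc, swap_mul_self, one_mul] at this
  exact this.symm

/-! ### Adding a fixed point -/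

/-- extend a permutation by the fixed point `0`. -/
def E {n : ℕ} (σ : Perm (Fin n)) : Perm (Fin (n+1)) := decomposeFin.symm (0, σ)

@[simp] theorem E_zero {n : ℕ} (σ : Perm (Fin n)) : E σ 0 = 0 := by simp [E]
@[simp] theorem E_succ {n : ℕ} (σ : Perm (Fin n)) (x : Fin n) : E σ x.succ = (σ x).succ := by
  simp [E]

theorem E_mul {n : ℕ} (σ ρ : Perm (Fin n)) : E (σ * ρ) = E σ * E ρ := by
  ext x
  cases x using Fin.cases <;> simp

theorem E_inv {n : ℕ} (σ : Perm (Fin n)) : E σ⁻¹ = (E σ)⁻¹ := by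
  rw [eq_inv_iff_mul_eq_one, ← E_mul]
  ext x
  cases x using Fin.cases <;> simp

theorem dS_eq {n : ℕ} (x : Fin (n+1)) (σ : Perm (Fin n)) :
    decomposeFin.symm (x, σ) = swap 0 x * E σ := by
  ext y
  cases y using Fin.cases <;> simp

theorem cyclesCount_E {n : ℕ} (σ : Perm (Fin n)) : cyclesCount (E σ) = cyclesCount σ + 1 := by
  have h : E σ = σ.extendDomain (finSuccAboveEquiv (0 : Fin (n+1))) := by
    ext x
    cases x using Fin.cases with
    | zero => rw [Perm.extendDomain_apply_not_subtype _ _ (by simp)]; simp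
    | succ x =>
      have := Perm.extendDomain_apply_image σ (finSuccAboveEquiv (0 : Fin (n+1))) x
      simp only [finSuccAboveEquiv_apply, Fin.zero_succAbove] at this
      rw [this, E_succ]
  have hc : (E σ).cycleType = σ.cycleType := by rw [h]; exact cycleType_extendDomain _
  unfold cyclesCount
  rw [parts_partition, parts_partition, ← sum_cycleType, ← sum_cycleType, hc]
  have := sum_cycleType_le σ
  simp only [Fintype.card_fin, Multiset.card_add, Multiset.card_replicate] at *
  omega

theorem not_sameCycle_E {n : ℕ} (σ : Perm (Fin n)) (x : Fin n) : ¬ SameCycle (E σ) 0 x.succ := by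
  rintro ⟨m, hm⟩
  rw [zpow_apply_eq_self_of_apply_eq_self (E_zero σ)] at hm
  exact (Fin.succ_ne_zero x) hm.symm

theorem cyclesCount_swap_E {n : ℕ} (σ : Perm (Fin n)) (x : Fin n) :
    cyclesCount (swap 0 x.succ * E σ) = cyclesCount σ := by
  have := cyclesCount_merge _ _ _ (not_sameCycle_E σ x)
  rw [cyclesCount_E] at this
  omega

/-- insertion of `0` in the cycle of the former zero. -/
def T {n : ℕ} (σ : Perm (Fin (n+1))) : Perm (Fin (n+2)) := swap 0 (σ 0).succ * E σ

theorem cyclesCount_T {n : ℕ} (σ : Perm (Fin (n+1))) : cyclesCount (T σ) = cyclesCount σ :=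
  cyclesCount_swap_E σ _

theorem per_T {n : ℕ} (σ : Perm (Fin (n+1))) :
    Function.minimalPeriod (T σ) 0 = Function.minimalPeriod σ 0 + 1 := by
  have hT0 : T σ 0 = (σ 0).succ := by simp [T]
  have hTs : ∀ x, x ≠ 0 → T σ x.succ = (σ x).succ := by
    intro x hx
    simp only [T, Perm.mul_apply, E_succ]
    apply swap_apply_of_ne_of_ne (Fin.succ_ne_zero _)
    simpa using hx
  have hT1 : T σ (0 : Fin (n+1)).succ = 0 := by
    simp only [T, Perm.mul_apply, E_succ, swap_apply_right]
  have key : ∀ m, m < Function.minimalPeriod σ 0 → (T σ)^[m+1] 0 = (σ^[m+1] 0).succ := by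
    intro m
    induction m with
    | zero => intro _; simpa using hT0
    | succ m ih =>
      intro hm
      rw [Function.iterate_succ_apply', ih (by omega), hTs _ (per_ne (by omega) hm),
        ← Function.iterate_succ_apply' σ]
  have hp := per_pos σ 0
  obtain ⟨q, hq⟩ : ∃ q, Function.minimalPeriod σ 0 = q + 1 := ⟨_, (Nat.succ_pred_eq_of_pos hp).symm⟩
  apply per_eq (by omega)
  · rw [Function.iterate_succ_apply', hq, key q (by omega), ← hq, Function.iterate_minimalPeriod, hT1]
  · intro m h0 hm
    obtain ⟨m, rfl⟩ : ∃ q, m = q + 1 := ⟨m - 1, by omega⟩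
    rw [key m (by omega)]
    exact Fin.succ_ne_zero _

/-! ### The complementary permutation -/

def W {n : ℕ} (v : Perm (Fin (n+1))) : Perm (Fin (n+1)) := v * (finRotate (n+1))⁻¹

theorem W_rec {n : ℕ} (x : Fin (n+2)) (v : Perm (Fin (n+1))) :
    W (decomposeFin.symm (x, v)) = swap 0 x * T (W v) := by
  have h1 : finRotate (n+2) = swap 0 1 * E (finRotate (n+1)) := by
    rw [← dS_eq]; exact finRotate_succ_eq_decomposeFin
  have h2 : (1 : Fin (n+2)) = (0 : Fin (n+1)).succ := rfl
  unfold W T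
  rw [dS_eq, h1, mul_inv_rev, swap_inv, mul_assoc, ← E_inv, ← mul_assoc (E v), ← E_mul,
    mul_swap_eq_swap_mul, h2, E_zero, E_succ]

theorem genus_le {n : ℕ} (v : Perm (Fin (n+1))) : cyclesCount v + cyclesCount (W v) ≤ n + 2 := by
  induction n with
  | zero =>
    have := cyclesCount_le v
    have := cyclesCount_le (W v)
    omega
  | succ n ih =>
    obtain ⟨⟨x, v⟩, rfl⟩ := decomposeFin.symm.surjective v
    have hv := ih v
    rw [W_rec, dS_eq]
    cases x using Fin.cases with
    | zero =>
      simp only [swap_self, ← Perm.one_def, one_mul, cyclesCount_E, cyclesCount_T]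
      omega
    | succ x =>
      rw [cyclesCount_swap_E]
      by_cases hs : SameCycle (T (W v)) 0 x.succ
      · rw [cyclesCount_split _ _ _ (Fin.succ_ne_zero x).symm hs, cyclesCount_T]
        omega
      · have := cyclesCount_merge _ _ _ hs
        rw [cyclesCount_T] at this
        omega

/-! ### Counting -/

def P (n j : ℕ) (v : Perm (Fin (n+1))) : Prop :=
  cyclesCount v = j ∧ cyclesCount v + cyclesCount (W v) = n + 2

open Classical in
noncomputable def G (n j l : ℕ) : ℕ :=
  #{v : Perm (Fin (n+1)) | P n j v ∧ Function.minimalPeriod (W v) 0 = l}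

open Classical in
noncomputable def S (n j l : ℕ) : ℕ :=
  #{v : Perm (Fin (n+1)) | P n j v ∧ l ≤ Function.minimalPeriod (W v) 0}

theorem S_succ (n j l : ℕ) : S n j l = S n j (l+1) + G n j l := by
  classical
  unfold S G
  rw [← card_union_of_disjoint]
  · congr 1
    ext v
    simp only [mem_filter, mem_univ, true_and, mem_union, ← and_or_left]
    constructor
    · rintro ⟨h, h'⟩; exact ⟨h, by omega⟩
    · rintro ⟨h, h'⟩; exact ⟨h, by omega⟩
  · rw [disjoint_left]
    intro v h1 h2
    simp only [mem_filter, mem_univ, true_and] at h1 h2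
    omega

open Classical in
theorem fiber (n j l : ℕ) (v : Perm (Fin (n+1))) :
    (∑ x : Fin (n+2), if P (n+1) (j+1) (decomposeFin.symm (x, v)) ∧
      Function.minimalPeriod (W (decomposeFin.symm (x, v))) 0 = l + 1 then 1 else 0) =
    (if P n j v ∧ Function.minimalPeriod (W v) 0 = l then 1 else 0) +
    (if P n (j+1) v ∧ l + 1 ≤ Function.minimalPeriod (W v) 0 then 1 else 0) := by
  rw [Fin.sum_univ_succ]
  congr 1
  · congr 1
    rw [W_rec]
    unfold P
    rw [W_rec, dS_eq]
    simp only [swap_self, ← Perm.one_def, one_mul, cyclesCount_E, cyclesCount_T, per_T]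
    apply propext
    omega
  · have hiff : ∀ x : Fin (n+1), (P (n+1) (j+1) (decomposeFin.symm (x.succ, v)) ∧
      Function.minimalPeriod (W (decomposeFin.symm (x.succ, v))) 0 = l + 1) ↔
      ((P n (j+1) v ∧ l + 1 ≤ Function.minimalPeriod (W v) 0) ∧ (T (W v))^[l+1] 0 = x.succ) := by
      intro x
      have hg := genus_le v
      unfold P
      rw [W_rec, dS_eq, cyclesCount_swap_E]
      by_cases hs : SameCycle (T (W v)) 0 x.succ
      · rw [cyclesCount_split _ _ _ (Fin.succ_ne_zero x).symm hs, cyclesCount_T]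
        obtain ⟨m, hm, hm'⟩ := (sameCycle_iff _ _ _).1 hs
        have hm0 : 0 < m := by
          rcases Nat.eq_zero_or_pos m with rfl | h
          · exact absurd hm'.symm (Fin.succ_ne_zero x)
          · exact h
        rw [← hm', per_swap _ _ _ hm0 hm]
        rw [per_T] at hm
        constructor
        · rintro ⟨⟨h1, h2⟩, rfl⟩
          exact ⟨⟨⟨h1, by omega⟩, by omega⟩, rfl⟩
        · rintro ⟨⟨⟨h1, h2⟩, h3⟩, h4⟩
          refine ⟨⟨h1, by omega⟩, ?_⟩
          exact ((Function.iterate_eq_iterate_iff_of_lt_minimalPeriod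
            (by rw [per_T]; omega) (by rw [per_T]; omega)).1 h4).symm
      · have := cyclesCount_merge _ _ _ hs
        rw [cyclesCount_T] at this
        constructor
        · rintro ⟨⟨h1, h2⟩, h3⟩
          omega
        · rintro ⟨⟨-, h3⟩, h4⟩
          exact absurd ((sameCycle_iff _ _ _).2 ⟨l+1, by rw [per_T]; omega, h4⟩) hs
    simp only [hiff]
    by_cases hQ : P n (j+1) v ∧ l + 1 ≤ Function.minimalPeriod (W v) 0
    · simp only [hQ, and_self, true_and, if_true]
      have hne : (T (W v))^[l+1] 0 ≠ 0 := per_ne (by omega) (by rw [per_T]; omega)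
      obtain ⟨y, hy⟩ := Fin.exists_succ_eq.2 hne
      rw [← hy]
      simp [Fin.succ_inj]
    · simp only [hQ, false_and, if_false, sum_const_zero]

theorem G_rec (n j l : ℕ) : G (n+1) (j+1) (l+1) = G n j l + S n (j+1) (l+1) := by
  classical
  unfold G S
  rw [card_filter, card_filter, card_filter, ← Equiv.sum_comp decomposeFin.symm,
    Fintype.sum_prod_type_right, ← sum_add_distrib]
  exact sum_congr rfl fun v _ => fiber n j l v

theorem S_zero_of_gt (n j l : ℕ) (h : n + 1 < l) : S n j l = 0 := by
  classical
  unfold S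
  rw [card_eq_zero, filter_eq_empty_iff]
  rintro v - ⟨-, h'⟩
  have := per_le (W v) 0
  omega

theorem S_j_zero (n l : ℕ) : S n 0 l = 0 := by
  classical
  unfold S
  rw [card_eq_zero, filter_eq_empty_iff]
  rintro v - ⟨⟨h', -⟩, -⟩
  have := cyclesCount_pos v
  omega

theorem S_j_gt (n j l : ℕ) (h : n + 1 < j) : S n j l = 0 := by
  classical
  unfold S
  rw [card_eq_zero, filter_eq_empty_iff]
  rintro v - ⟨⟨h', -⟩, -⟩
  have := cyclesCount_le v
  omega

theorem S_l_zero (n j : ℕ) : S n j 0 = S n j 1 := by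
  classical
  unfold S
  congr 1
  ext v
  have := per_pos (W v) 0
  simp only [mem_filter, mem_univ, true_and]
  constructor
  · rintro ⟨h, -⟩; exact ⟨h, this⟩
  · rintro ⟨h, -⟩; exact ⟨h, by omega⟩

theorem S_base : S 0 1 1 = 1 := by
  classical
  unfold S
  rw [card_eq_one]
  refine ⟨1, ?_⟩
  ext v
  obtain rfl : v = (1 : Perm (Fin 1)) := by
    apply Equiv.ext; intro x; exact Subsingleton.elim (α := Fin 1) _ _
  simp only [mem_filter, mem_univ, true_and, mem_singleton, iff_true]
  have h1 := cyclesCount_pos (1 : Perm (Fin 1))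
  have h2 := cyclesCount_le (1 : Perm (Fin 1))
  have h3 := cyclesCount_pos (W (1 : Perm (Fin 1)))
  have h4 := cyclesCount_le (W (1 : Perm (Fin 1)))
  refine ⟨⟨by omega, by omega⟩, per_pos _ _⟩

theorem S_step (n j l : ℕ) : S (n+1) (j+1) (l+1) + S n j (l+1) =
    S (n+1) (j+1) (l+2) + S n j l + S n (j+1) (l+1) := by
  rw [S_succ (n+1) (j+1) (l+1), G_rec, S_succ n j l]
  ring

theorem num (k l e r : ℕ) (hk : k = l + e + 1) :
    (k : ℚ) * (k+1).choose (r+1) * (l+1) * e.choose r =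
    (k+1) * (k.choose (r+1) * l * e.choose r +
      k.choose r * ((l+1) * e.choose r + e.choose (r+1))) := by
  have a1 : ((k+1).choose (r+1) : ℚ) * (r+1) = (k+1) * k.choose r := by
    exact_mod_cast (Nat.add_one_mul_choose_eq k r).symm
  have a2 : (k.choose (r+1) : ℚ) + k.choose r = (k+1).choose (r+1) := by
    rw [Nat.choose_succ_succ' k r]; push_cast; ring
  have a3 : (e.choose (r+1) : ℚ) * (r+1) + r * e.choose r = e * e.choose r := by
    have h1 : ((e+1).choose (r+1) : ℚ) * (r+1) = (e+1) * e.choose r := by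
      exact_mod_cast (Nat.add_one_mul_choose_eq e r).symm
    rw [Nat.choose_succ_succ' e r] at h1
    push_cast at h1
    linarith
  have hr : (r + 1 : ℚ) ≠ 0 := by positivity
  have hk' : (k : ℚ) = l + e + 1 := by rw [hk]; push_cast; ring
  have b1 : ((k+1).choose (r+1) : ℚ) = (k+1) * k.choose r / (r+1) := by
    rw [eq_div_iff hr, a1]
  have b2 : (k.choose (r+1) : ℚ) = (k+1) * k.choose r / (r+1) - k.choose r := by
    rw [← b1, ← a2]; ring
  have b3 : (e.choose (r+1) : ℚ) = (e - r) * e.choose r / (r+1) := by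
    rw [eq_div_iff hr]; linarith
  rw [b1, b2, b3, hk']
  field_simp
  ring

theorem S_formula (n : ℕ) : ∀ d j r l, j + r = n + 1 → l + d = n + 1 →
    (S n j l : ℚ) = (n+1).choose r * (l * d.choose r + d.choose (r+1)) / (n+1) := by
  induction n with
  | zero =>
    have h11 := S_base
    have h10 : S 0 1 0 = 1 := by rw [S_l_zero, S_base]
    intro d j r l hj hl
    have : j = 0 ∨ j = 1 := by omega
    have : l = 0 ∨ l = 1 := by omega
    rcases ‹j = 0 ∨ j = 1› with rfl | rfl <;> rcases ‹l = 0 ∨ l = 1› with rfl | rfl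
    · obtain rfl : r = 1 := by omega
      obtain rfl : d = 1 := by omega
      simp [S_j_zero]
    · obtain rfl : r = 1 := by omega
      obtain rfl : d = 0 := by omega
      simp [S_j_zero]
    · obtain rfl : r = 0 := by omega
      obtain rfl : d = 1 := by omega
      simp [h10]
    · obtain rfl : r = 0 := by omega
      obtain rfl : d = 0 := by omega
      simp [h11]
  | succ n ih =>
    have main : ∀ d j r l, j + r = n + 1 → l + d = n + 1 →
        (S (n+1) (j+1) (l+1) : ℚ) =
          (n+2).choose r * ((l+1) * d.choose r + d.choose (r+1)) / (n+2) := by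
      intro d
      induction d with
      | zero =>
        intro j r l hj hl
        have h := S_step n j l
        rw [S_zero_of_gt n j (l+1) (by omega), S_zero_of_gt n (j+1) (l+1) (by omega),
          S_zero_of_gt (n+1) (j+1) (l+2) (by omega)] at h
        have h' : (S (n+1) (j+1) (l+1) : ℚ) = S n j l := by
          have : S (n+1) (j+1) (l+1) = S n j l := by omega
          exact_mod_cast this
        rw [h', ih 0 j r l hj hl]
        have hl' : (l : ℚ) = n + 1 := by exact_mod_cast hl
        have : (n + 1 : ℚ) ≠ 0 := by positivity
        have : (n + 2 : ℚ) ≠ 0 := by positivity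
        rcases r with _ | r
        · simp [hl']
          field_simp
          ring
        · simp
      | succ d ihd =>
        intro j r l hj hl
        have h := S_step n j l
        have h' : (S (n+1) (j+1) (l+1) : ℚ) + S n j (l+1) =
          S (n+1) (j+1) (l+2) + S n j l + S n (j+1) (l+1) := by exact_mod_cast h
        have e1 := ih d j r (l+1) hj (by omega)
        have e2 := ih (d+1) j r l hj hl
        have e3 := ihd j r (l+1) hj (by omega)
        have n1 : (n + 1 : ℚ) ≠ 0 := by positivity
        have n2 : (n + 2 : ℚ) ≠ 0 := by positivity
        rcases r with _ | r
        · rw [S_j_gt n (j+1) (l+1) (by omega)] at h'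
          have h3 : (S (n+1) (j+1) (l+1) : ℚ) =
            S (n+1) (j+1) (l+2) + S n j l - S n j (l+1) := by
            push_cast at h'; linarith
          rw [h3, e1, e2, e3]
          simp
          field_simp
          ring
        · have e4 := ih d (j+1) r (l+1) (by omega) (by omega)
          have h3 : (S (n+1) (j+1) (l+1) : ℚ) =
            S (n+1) (j+1) (l+2) + S n j l + S n (j+1) (l+1) - S n j (l+1) := by
            linarith
          have hn := num (n+1) l d r (by omega)
          rw [h3, e1, e2, e3, e4]
          simp only [Nat.choose_succ_succ' d]
          push_cast at hn ⊢
          field_simp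
          linear_combination (-1 : ℚ) * hn
    intro d j r l hj hl
    rcases j with _ | j
    · rw [S_j_zero]
      obtain rfl : r = n + 2 := by omega
      rw [Nat.choose_eq_zero_of_lt (show d < n + 2 + 1 by omega)]
      rcases Nat.eq_zero_or_pos l with rfl | hl0
      · simp
      · rw [Nat.choose_eq_zero_of_lt (show d < n + 2 by omega)]
        simp
    · rcases l with _ | l
      · rw [S_l_zero]
        obtain rfl : d = n + 2 := by omega
        have := main (n+1) j r 0 (by omega) (by omega)
        rw [this, Nat.choose_succ_succ' (n+1) r]
        push_cast
        ring
      · have := main d j r l (by omega) (by omega)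
        rw [this]
        push_cast
        ring

end Nara

theorem narayana_counts_cycle_factorizations (k i : ℕ) (hk : 1 ≤ k) (hi1 : 1 ≤ i)
    (hik : i ≤ k) :
    ((Finset.univ.filter fun uv : Equiv.Perm (Fin k) × Equiv.Perm (Fin k) =>
        uv.1 * uv.2 = finRotate k ∧ cyclesCount uv.1 = i ∧ cyclesCount uv.2 = k + 1 - i).card : ℚ)
      = (1 / (k : ℚ)) * (k.choose i : ℚ) * (k.choose (i - 1) : ℚ) := by
  classical
  obtain ⟨n, rfl⟩ : ∃ n, k = n + 1 := ⟨k - 1, by omega⟩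
  obtain ⟨r, rfl⟩ : ∃ r, i = r + 1 := ⟨i - 1, by omega⟩
  have hS := Nara.S_formula n (n+1) (n + 1 - r) r 0 (by omega) (by omega)
  have hcard : (Finset.univ.filter fun uv : Equiv.Perm (Fin (n+1)) × Equiv.Perm (Fin (n+1)) =>
        uv.1 * uv.2 = finRotate (n+1) ∧ cyclesCount uv.1 = r + 1 ∧
          cyclesCount uv.2 = n + 1 + 1 - (r + 1)).card = Nara.S n (n + 1 - r) 0 := by
    unfold Nara.S
    have hW : ∀ u v : Equiv.Perm (Fin (n+1)), u * v = finRotate (n+1) → Nara.W v = u⁻¹ := by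
      intro u v h
      rw [Nara.W, ← h]
      group
    apply Finset.card_bij (fun uv _ => uv.2)
    · rintro ⟨u, v⟩ h
      simp only [Finset.mem_filter, Finset.mem_univ, true_and] at h ⊢
      obtain ⟨h1, h2, h3⟩ := h
      unfold Nara.P
      rw [hW u v h1, Nara.cyclesCount_inv]
      omega
    · rintro ⟨u, v⟩ h ⟨u', v'⟩ h' hv
      simp only [Finset.mem_filter, Finset.mem_univ, true_and] at h h' hv
      subst hv
      have := h.1.trans h'.1.symm
      rw [mul_right_cancel this]
    · intro v h
      simp only [Finset.mem_filter, Finset.mem_univ, true_and] at h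
      obtain ⟨⟨h1, h2⟩, -⟩ := h
      refine ⟨((Nara.W v)⁻¹, v), ?_, rfl⟩
      simp only [Finset.mem_filter, Finset.mem_univ, true_and]
      rw [Nara.cyclesCount_inv]
      refine ⟨?_, by omega, by omega⟩
      rw [Nara.W]
      group
  rw [hcard, hS]
  simp only [Nat.add_sub_cancel]
  push_cast
  ring
end
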